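/- arXiv:1406.6393 — 3 statements merged into one kernel-verified Lean document; each statement's English description precedes it below -/
import Mathlib

section
/- Let (X, C) be a closure space, Φ, Ψ ⊆ X, and x ∈ X. Suppose x satisfies Φ U Ψ, i.e., there exists A ⊆ X with x ∈ A, A ⊆ Φ, and C(A) \ A ⊆ Ψ. Then for every path p from x and every l ∈ ℕ such that p(l) ∉ Φ, there exists k with 1 ≤ k ≤ l and p(k) ∈ Ψ. -/
/-- The closure operator on ℕ induced by the successor relation:
    C_succ(S) = S ∪ {m | ∃ n ∈ S, m = n + 1}. -/
def succClosure (S : Set ℕ) : Set ℕ :=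
  S ∪ {m : ℕ | ∃ n ∈ S, m = n + 1}

/-- A path in a closure space (X, C) is a closure-continuous function
    p : (ℕ, C_succ) → (X, C), i.e., p(C_succ(S)) ⊆ C(p(S)) for all S ⊆ ℕ. -/
def IsPath {X : Type*} (C : Set X → Set X) (p : ℕ → X) : Prop :=
  ∀ S : Set ℕ, p '' succClosure S ⊆ C (p '' S)

/-- If x satisfies Φ U Ψ in a closure space (X, C), then for every
    path p from x and every l with p(l) ∉ Φ, there is k, 1 ≤ k ≤ l, p(k) ∈ Ψ. -/
theorem until_implies_path_property {X : Type*} (C : Set X → Set X)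
    (h_empty : C ∅ = ∅)
    (h_sub : ∀ A : Set X, A ⊆ C A)
    (h_union : ∀ A B : Set X, C (A ∪ B) = C A ∪ C B)
    (Φ Ψ : Set X) (x : X)
    (hU : ∃ A : Set X, x ∈ A ∧ A ⊆ Φ ∧ C A \ A ⊆ Ψ) :
    ∀ p : ℕ → X, IsPath C p → p 0 = x →
      ∀ l : ℕ, p l ∉ Φ → ∃ k, 1 ≤ k ∧ k ≤ l ∧ p k ∈ Ψ := by
  obtain ⟨A, hxA, hAΦ, hAΨ⟩ := hU
  intro p hp h0 l hl
  have h_mono : Monotone C := fun S T hST ↦ by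
    rw [← Set.union_eq_self_of_subset_left hST, h_union]
    exact Set.subset_union_left
  by_contra! h
  have h_mem : ∀ j ≤ l, p j ∈ A := by
    intro j
    induction j with
    | zero => exact fun _ ↦ h0 ▸ hxA
    | succ j ih =>
      intro hj
      by_contra hjA
      have hpC : p (j + 1) ∈ C (p '' {j}) :=
        hp {j} (Set.mem_image_of_mem p (Or.inr ⟨j, rfl, rfl⟩))
      have hjC : p '' {j} ⊆ A := by
        simpa using ih (by omega)
      exact h (j + 1) (by omega) hj (hAΨ ⟨h_mono hjC hpC, hjA⟩)
  exact hl (hAΦ (h_mem l le_rfl))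
end

section
/- Let X be a set, R ⊆ X × X a relation, Φ, Ψ ⊆ X, and x ∈ X. In the quasi-discrete closure space (X, C_R), x satisfies Φ U Ψ (i.e., there exists A ⊆ X with x ∈ A, A ⊆ Φ, and C_R(A) \ A ⊆ Ψ) if and only if x ∈ Φ and for every path p from x and every l ∈ ℕ such that p(l) ∉ Φ, there exists k with 1 ≤ k ≤ l and p(k) ∈ Ψ. -/
/-- The closure operator induced by a relation R:
    C_R(A) = A ∪ {x | ∃ a ∈ A, (a,x) ∈ R}. -/
def relClosure {X : Type*} (R : X → X → Prop) (A : Set X) : Set X :=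
  A ∪ {x : X | ∃ a ∈ A, R a x}

theorem isPath_relClosure_iff {X : Type*} (R : X → X → Prop) (p : ℕ → X) :
    IsPath (relClosure R) p ↔ ∀ n, p (n + 1) = p n ∨ R (p n) (p (n + 1)) := by
  constructor
  · intro h n
    have := h {n} ⟨n + 1, Or.inr ⟨n, rfl, rfl⟩, rfl⟩
    simpa [relClosure] using this
  · rintro h S _ ⟨m, hm | ⟨n, hn, rfl⟩, rfl⟩
    · exact Or.inl ⟨m, hm, rfl⟩
    · rcases h n with h | h
      · exact Or.inl ⟨n, hn, h.symm⟩
      · exact Or.inr ⟨p n, ⟨n, hn, rfl⟩, h⟩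

/-- A point reachable through `R`-steps landing outside `Ψ` is reached by a path that avoids `Ψ`
after its starting point. -/
theorem exists_isPath_of_reflTransGen {X : Type*} {R : X → X → Prop} {Ψ : Set X} {x y : X}
    (h : Relation.ReflTransGen (fun a b => R a b ∧ b ∉ Ψ) x y) :
    ∃ (p : ℕ → X) (l : ℕ), IsPath (relClosure R) p ∧ p 0 = x ∧ p l = y ∧
      ∀ k, 1 ≤ k → k ≤ l → p k ∉ Ψ := by
  simp only [isPath_relClosure_iff]
  induction h with
  | refl => exact ⟨fun _ => x, 0, fun _ => Or.inl rfl, rfl, rfl, by omega⟩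
  | @tail b c _ hbc ih =>
    obtain ⟨p, l, hp, h0, hl, hΨ⟩ := ih
    refine ⟨fun k => if k ≤ l then p k else c, l + 1, fun n => ?_, by simpa using h0, by simp,
      fun k hk _ => ?_⟩
    · rcases lt_trichotomy n l with hn | rfl | hn
      · simpa [hn.le, Nat.succ_le_of_lt hn] using hp n
      · simpa [hl] using Or.inr hbc.1
      · simp [show ¬ n ≤ l by omega, show ¬ n + 1 ≤ l by omega]
    · by_cases hkl : k ≤ l
      · simpa [hkl] using hΨ k hk hkl
      · simpa [hkl] using hbc.2

/-- In (X, C_R), x satisfies Φ U Ψ iff x ∈ Φ and for every path p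
    from x and every l with p(l) ∉ Φ, there is k, 1 ≤ k ≤ l, with p(k) ∈ Ψ. -/
theorem until_iff_path_property {X : Type*} (R : X → X → Prop)
    (Φ Ψ : Set X) (x : X) :
    (∃ A : Set X, x ∈ A ∧ A ⊆ Φ ∧ relClosure R A \ A ⊆ Ψ) ↔
      (x ∈ Φ ∧ ∀ p : ℕ → X, IsPath (relClosure R) p → p 0 = x →
        ∀ l : ℕ, p l ∉ Φ → ∃ k, 1 ≤ k ∧ k ≤ l ∧ p k ∈ Ψ) := by
  constructor
  · rintro ⟨A, hx, hA, hΨ⟩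
    refine ⟨hA hx, fun p hp h0 l hl => ?_⟩
    rw [isPath_relClosure_iff] at hp
    by_contra! hk
    have mem : ∀ k ≤ l, p k ∈ A := by
      intro k
      induction k with
      | zero => exact fun _ => h0 ▸ hx
      | succ k ih =>
        intro hkl
        have hkA := ih (by omega)
        by_contra hn
        refine hk (k + 1) (by omega) hkl (hΨ ⟨?_, hn⟩)
        rcases hp k with h | h
        · exact Or.inl (h ▸ hkA)
        · exact Or.inr ⟨p k, hkA, h⟩
    exact hl (hA (mem l le_rfl))
  · rintro ⟨_, h⟩
    refine ⟨{y | Relation.ReflTransGen (fun a b => R a b ∧ b ∉ Ψ) x y}, .refl, fun y hy => ?_, ?_⟩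
    · obtain ⟨p, l, hp, h0, rfl, hΨ⟩ := exists_isPath_of_reflTransGen hy
      by_contra hn
      obtain ⟨k, hk, hkl, hkΨ⟩ := h p hp h0 l hn
      exact hΨ k hk hkl hkΨ
    · rintro y ⟨hy | ⟨a, ha, hay⟩, hn⟩
      · exact absurd hy hn
      · by_contra hyΨ
        exact hn (.tail ha ⟨hay, hyΨ⟩)
end

section
/- Let X be a set, R ⊆ X × X a relation, Φ, Ψ ⊆ X, and x ∈ X. In the quasi-discrete closure space (X, C_R), x satisfies the dual reachability formula Φ R̃ Ψ, defined as the negation of (X \ Ψ) U (X \ Φ), if and only if there exist a path p from x and k ∈ ℕ such that p(k) ∈ Ψ and p(j) ∈ Φ for all j with 1 ≤ j ≤ k. -/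
/-- x satisfies Φ U Ψ in (X, C): ∃ A, x ∈ A, A ⊆ Φ, C(A) \ A ⊆ Ψ. -/
def SatUntil {X : Type*} (C : Set X → Set X) (Φ Ψ : Set X) (x : X) : Prop :=
  ∃ A : Set X, x ∈ A ∧ A ⊆ Φ ∧ C A \ A ⊆ Ψ

/-- A point reachable from `x` by `R`-steps landing in `Φ` lies on a path from `x` that stays
in `Φ` after its start and is eventually constant. -/
theorem exists_path_of_reflTransGen {X : Type*} {R : X → X → Prop} {Φ : Set X} {x y : X}
    (h : Relation.ReflTransGen (fun a b => R a b ∧ b ∈ Φ) x y) :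
    ∃ p : ℕ → X, IsPath (relClosure R) p ∧ p 0 = x ∧
      ∃ k : ℕ, p k = y ∧ ∀ j, 1 ≤ j → j ≤ k → p j ∈ Φ := by
  simp only [isPath_relClosure_iff]
  induction h with
  | refl => exact ⟨fun _ => x, fun _ => Or.inl rfl, rfl, 0, rfl, fun j h₁ h₂ => by omega⟩
  | @tail b c _ hbc ih =>
    obtain ⟨p, hp, h0, k, hk, hΦ⟩ := ih
    refine ⟨fun n => if n ≤ k then p n else c, fun n => ?_, by simpa using h0, k + 1,
      by simp, fun j h₁ h₂ => ?_⟩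
    · rcases lt_trichotomy n k with hn | rfl | hn
      · simpa [hn.le, Nat.succ_le_of_lt hn] using hp n
      · simpa [hk] using Or.inr hbc.1
      · simp [hn.not_ge, (hn.trans n.lt_succ_self).not_ge]
    · by_cases hj : j ≤ k
      · simpa [hj] using hΦ j h₁ hj
      · simpa [hj] using hbc.2

/-- In (X, C_R), x satisfies Φ R̃ Ψ := ¬((X \ Ψ) U (X \ Φ)) iff
    there exist a path p from x and k ∈ ℕ with p(k) ∈ Ψ and p(j) ∈ Φ for
    1 ≤ j ≤ k. -/
theorem dual_reach_iff_path {X : Type*} (R : X → X → Prop)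
    (Φ Ψ : Set X) (x : X) :
    ¬ SatUntil (relClosure R) Ψᶜ Φᶜ x ↔
      ∃ p : ℕ → X, IsPath (relClosure R) p ∧ p 0 = x ∧
        ∃ k : ℕ, p k ∈ Ψ ∧ ∀ j, 1 ≤ j → j ≤ k → p j ∈ Φ := by
  constructor
  · intro h
    by_contra hno
    refine h ⟨{y | Relation.ReflTransGen (fun a b => R a b ∧ b ∈ Φ) x y},
      Relation.ReflTransGen.refl, fun y hy hΨ => ?_, ?_⟩
    · obtain ⟨p, hp, h0, k, rfl, hΦ⟩ := exists_path_of_reflTransGen hy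
      exact hno ⟨p, hp, h0, k, hΨ, hΦ⟩
    · rintro z ⟨hz | ⟨a, ha, haz⟩, hzA⟩ hzΦ
      · exact hzA hz
      · exact hzA (Relation.ReflTransGen.tail ha ⟨haz, hzΦ⟩)
  · rintro ⟨p, hp, rfl, k, hk, hΦ⟩ ⟨A, hxA, hAΨ, hA⟩
    rw [isPath_relClosure_iff] at hp
    have hmem : ∀ j, j ≤ k → p j ∈ A := by
      intro j
      induction j with
      | zero => exact fun _ => hxA
      | succ j ih =>
        intro hj
        have hjA := ih (by omega)
        by_contra hnot
        refine hA ⟨?_, hnot⟩ (hΦ (j + 1) (by omega) hj)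
        rcases hp j with h | h
        · exact Or.inl (h ▸ hjA)
        · exact Or.inr ⟨p j, hjA, h⟩
    exact hAΨ (hmem k le_rfl) hk
end
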